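/- Let N ≥ 2 and let Sα = (1/2) Σ_{n=1}^{N} σα^(n) (α = x,y,z) be the collective spin operators of an N-qubit system, and for nonnegative reals γx, γy, γz define the collective-decoherence generator 𝒟(X) = −Σ_{α∈{x,y,z}} γα (Sα²X + XSα² − 2SαXSα). Then for every 1 ≤ n ≤ N−1 the Heisenberg exchange coupling is a fixed point of the generator: 𝒟( σx^(n)σx^(n+1) + σy^(n)σy^(n+1) + σz^(n)σz^(n+1) ) = 0. -/

import Mathlib

/- N-qubit operators: matrices indexed by `Fin N → Fin 2`, identified with
Kronecker products. Sites are labeled `1, …, N`. -/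

noncomputable def pauli : Fin 3 → Matrix (Fin 2) (Fin 2) ℂ :=
  ![!![0, 1; 1, 0], !![0, -Complex.I; Complex.I, 0], !![1, 0; 0, -1]]

/-- The Pauli matrix `σ_a` acting on qubit `n` (sites labeled `1, …, N`) and as the
identity elsewhere. -/
noncomputable def pauliAt (N n : ℕ) (a : Fin 3) :
    Matrix (Fin N → Fin 2) (Fin N → Fin 2) ℂ :=
  Matrix.of fun f g =>
    ∏ m : Fin N, if (m : ℕ) + 1 = n then pauli a (f m) (g m)
      else (if f m = g m then 1 else 0)


/-- Collective spin operator `S_a = (1/2) Σ_{n=1}^N σ_a^(n)`. -/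
noncomputable def collSpin (N : ℕ) (a : Fin 3) :
    Matrix (Fin N → Fin 2) (Fin N → Fin 2) ℂ :=
  ((1 : ℂ) / 2) • ∑ n ∈ Finset.Icc 1 N, pauliAt N n a

/-- Collective-decoherence generator
`𝒟(X) = −Σ_α γ_α (S_α²X + XS_α² − 2S_αXS_α)` with rates `γ : Fin 3 → ℝ`. -/
noncomputable def collDeco (N : ℕ) (γ : Fin 3 → ℝ)
    (X : Matrix (Fin N → Fin 2) (Fin N → Fin 2) ℂ) :
    Matrix (Fin N → Fin 2) (Fin N → Fin 2) ℂ :=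
  -∑ a : Fin 3, γ a •
    (collSpin N a ^ 2 * X + X * collSpin N a ^ 2
      - (2 : ℂ) • (collSpin N a * X * collSpin N a))

/-- The Kronecker product of one-qubit operators. -/
def tensorOp {N : ℕ} (A : Fin N → Matrix (Fin 2) (Fin 2) ℂ) :
    Matrix (Fin N → Fin 2) (Fin N → Fin 2) ℂ :=
  Matrix.of fun f g => ∏ m, A m (f m) (g m)

theorem tensorOp_mul {N : ℕ} (A B : Fin N → Matrix (Fin 2) (Fin 2) ℂ) :
    tensorOp A * tensorOp B = tensorOp (A * B) := by
  ext f g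
  simp only [tensorOp, Matrix.mul_apply, Matrix.of_apply, Pi.mul_apply,
    ← Finset.prod_mul_distrib, Finset.prod_univ_sum, Fintype.piFinset_univ]

/-- The one-qubit operator `M` acting on site `n` (labeled from `1`). -/
def siteOp (N n : ℕ) (M : Matrix (Fin 2) (Fin 2) ℂ) :
    Matrix (Fin N → Fin 2) (Fin N → Fin 2) ℂ :=
  tensorOp fun m : Fin N => if (m : ℕ) + 1 = n then M else 1

theorem pauliAt_eq_siteOp (N n : ℕ) (a : Fin 3) : pauliAt N n a = siteOp N n (pauli a) := by
  ext f g
  simp only [pauliAt, siteOp, tensorOp, Matrix.of_apply]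
  refine Finset.prod_congr rfl fun m _ => ?_
  split_ifs <;> simp_all [Matrix.one_apply]

theorem siteOp_mul (N n : ℕ) (A B : Matrix (Fin 2) (Fin 2) ℂ) :
    siteOp N n A * siteOp N n B = siteOp N n (A * B) := by
  rw [siteOp, siteOp, tensorOp_mul, siteOp]
  congr 1
  ext1 m
  simp only [Pi.mul_apply]
  split_ifs <;> simp

theorem siteOp_commute (N : ℕ) {k l : ℕ} (h : k ≠ l) (A B : Matrix (Fin 2) (Fin 2) ℂ) :
    Commute (siteOp N k A) (siteOp N l B) := by
  rw [commute_iff_eq, siteOp, siteOp, tensorOp_mul, tensorOp_mul]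
  congr 1
  ext1 m
  simp only [Pi.mul_apply]
  split_ifs <;> first | omega | simp

theorem siteOp_smul {N n : ℕ} (h₁ : 1 ≤ n) (h₂ : n ≤ N) (c : ℂ) (A : Matrix (Fin 2) (Fin 2) ℂ) :
    siteOp N n (c • A) = c • siteOp N n A := by
  ext f g
  have hm : ∀ m : Fin N, (m : ℕ) + 1 = n ↔ m = ⟨n - 1, by omega⟩ := fun m => by
    rw [Fin.ext_iff]; simp only; omega
  simp only [siteOp, tensorOp, Matrix.of_apply, Matrix.smul_apply, hm, smul_eq_mul]
  rw [← Finset.mul_prod_erase _ _ (Finset.mem_univ (⟨n - 1, by omega⟩ : Fin N)),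
    ← Finset.mul_prod_erase _ _ (Finset.mem_univ (⟨n - 1, by omega⟩ : Fin N))]
  simp only [if_true, Matrix.smul_apply, smul_eq_mul, mul_assoc]
  congr 2
  refine Finset.prod_congr rfl fun m hm => ?_
  rw [if_neg (Finset.ne_of_mem_erase hm), if_neg (Finset.ne_of_mem_erase hm)]

theorem pauli_mul_succ (a : Fin 3) : pauli a * pauli (a + 1) = Complex.I • pauli (a + 2) := by
  fin_cases a <;> ext i j <;> fin_cases i <;> fin_cases j <;> simp [pauli, Matrix.mul_apply]

theorem pauli_succ_mul (a : Fin 3) : pauli (a + 1) * pauli a = (-Complex.I) • pauli (a + 2) := by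
  fin_cases a <;> ext i j <;> fin_cases i <;> fin_cases j <;> simp [pauli, Matrix.mul_apply]

theorem pauliAt_mul_succ {N n : ℕ} (h₁ : 1 ≤ n) (h₂ : n ≤ N) (a : Fin 3) :
    pauliAt N n a * pauliAt N n (a + 1) = Complex.I • pauliAt N n (a + 2) := by
  simp only [pauliAt_eq_siteOp, siteOp_mul, pauli_mul_succ, siteOp_smul h₁ h₂]

theorem pauliAt_succ_mul {N n : ℕ} (h₁ : 1 ≤ n) (h₂ : n ≤ N) (a : Fin 3) :
    pauliAt N n (a + 1) * pauliAt N n a = (-Complex.I) • pauliAt N n (a + 2) := by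
  simp only [pauliAt_eq_siteOp, siteOp_mul, pauli_succ_mul, siteOp_smul h₁ h₂]

theorem pauliAt_commute (N : ℕ) {k l : ℕ} (h : k ≠ l) (a b : Fin 3) :
    Commute (pauliAt N k a) (pauliAt N l b) := by
  simpa only [pauliAt_eq_siteOp] using siteOp_commute N h _ _

theorem commute_add_exchange {R : Type*} [Ring R] [Algebra ℂ R] {p q : Fin 3 → R}
    (hpq : ∀ a b, Commute (p a) (q b))
    (hp : ∀ a, p a * p (a + 1) = Complex.I • p (a + 2))
    (hp' : ∀ a, p (a + 1) * p a = (-Complex.I) • p (a + 2))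
    (hq : ∀ a, q a * q (a + 1) = Complex.I • q (a + 2))
    (hq' : ∀ a, q (a + 1) * q a = (-Complex.I) • q (a + 2)) (a : Fin 3) :
    Commute (p a + q a) (∑ b, p b * q b) := by
  have hsum : ∑ b, p b * q b = p a * q a + p (a + 1) * q (a + 1) + p (a + 2) * q (a + 2) := by
    rw [Fin.sum_univ_three]
    fin_cases a
    · rfl
    · exact (add_assoc _ _ _).trans (add_comm _ _)
    · exact add_comm _ _ |>.trans (add_assoc _ _ _).symm
  have h3 : a + 2 + 1 = a := by fin_cases a <;> rfl
  have h4 : a + 2 + 2 = a + 1 := by fin_cases a <;> rfl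
  have hp2 := hp (a + 2)
  have hp2' := hp' (a + 2)
  have hq2 := hq (a + 2)
  have hq2' := hq' (a + 2)
  rw [h3, h4] at hp2 hp2' hq2 hq2'
  have hl (b : Fin 3) : p a * (p b * q b) = p a * p b * q b := (mul_assoc _ _ _).symm
  have hr (b : Fin 3) : p b * q b * p a = p b * p a * q b := by
    rw [mul_assoc, ← (hpq a b).eq, mul_assoc]
  have hl' (b : Fin 3) : q a * (p b * q b) = p b * (q a * q b) := by
    rw [← mul_assoc, ← (hpq b a).eq, mul_assoc]
  have hr' (b : Fin 3) : p b * q b * q a = p b * (q b * q a) := mul_assoc _ _ _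
  rw [hsum, commute_iff_eq]
  simp only [add_mul, mul_add, hl, hr, hl', hr', hp a, hp' a, hq a, hq' a, hp2, hp2', hq2, hq2',
    smul_mul_assoc, mul_smul_comm, neg_smul, neg_mul, mul_neg]
  abel

theorem collSpin_commute_exchange {N n : ℕ} (hn1 : 1 ≤ n) (hn2 : n + 1 ≤ N) (a : Fin 3) :
    Commute (collSpin N a) (∑ b, pauliAt N n b * pauliAt N (n + 1) b) := by
  refine Commute.smul_left ?_ _
  have hmem : n ∈ Finset.Icc 1 N := Finset.mem_Icc.2 ⟨hn1, by omega⟩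
  have hmem' : n + 1 ∈ (Finset.Icc 1 N).erase n := by simp; omega
  rw [← Finset.add_sum_erase _ _ hmem, ← Finset.add_sum_erase _ _ hmem', ← add_assoc]
  refine Commute.add_left ?_ (Commute.sum_left _ _ _ fun k hk => ?_)
  · exact commute_add_exchange (p := pauliAt N n) (q := pauliAt N (n + 1))
      (pauliAt_commute N (by omega))
      (pauliAt_mul_succ hn1 (by omega)) (pauliAt_succ_mul hn1 (by omega))
      (pauliAt_mul_succ (by omega) hn2) (pauliAt_succ_mul (by omega) hn2) a
  · simp only [Finset.mem_erase] at hk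
    exact Commute.sum_right _ _ _ fun b _ =>
      (pauliAt_commute N hk.2.1 a b).mul_right (pauliAt_commute N hk.1 a b)

theorem collDeco_eq_zero_of_commute {N : ℕ} (γ : Fin 3 → ℝ)
    {X : Matrix (Fin N → Fin 2) (Fin N → Fin 2) ℂ} (h : ∀ a, Commute (collSpin N a) X) :
    collDeco N γ X = 0 := by
  rw [collDeco, neg_eq_zero]
  refine Finset.sum_eq_zero fun a _ => ?_
  rw [((h a).pow_left 2).eq, (h a).eq, mul_assoc, ← sq, two_smul, sub_self, smul_zero]

/-- Under collective decoherence with rates `γx, γy, γz ≥ 0`, for `1 ≤ n ≤ N − 1`,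
the Heisenberg exchange coupling is a fixed point of the generator:
`𝒟(σx^(n)σx^(n+1) + σy^(n)σy^(n+1) + σz^(n)σz^(n+1)) = 0`. -/
theorem collDeco_heisenberg_fixed (N : ℕ) (hN : 2 ≤ N) (γ : Fin 3 → ℝ) (hγ : ∀ a, 0 ≤ γ a)
    (n : ℕ) (hn1 : 1 ≤ n) (hnN : n ≤ N - 1) :
    collDeco N γ
      (pauliAt N n 0 * pauliAt N (n + 1) 0
        + pauliAt N n 1 * pauliAt N (n + 1) 1
        + pauliAt N n 2 * pauliAt N (n + 1) 2) = 0 := by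
  rw [← Fin.sum_univ_three fun b => pauliAt N n b * pauliAt N (n + 1) b]
  exact collDeco_eq_zero_of_commute γ (collSpin_commute_exchange hn1 (by omega))
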